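/- There exists a constant C > 0 such that for all integers n ≥ 0 and all integers k with 0 ≤ k ≤ n, |(ν_{n,k} − μ_{n,k}²) − 2^k · G(2^{−k} n)| ≤ C. (That is, the variance of the external profile of a random symmetric digital search tree satisfies Var(B_{n,k}) = 2^k G(2^{−k} n) + O(1) uniformly for 0 ≤ k ≤ n.) -/

import Mathlib

open Filter Real

/-- `Q j = ∏_{ℓ=1}^{j} (1 - 2^{-ℓ})`. -/
noncomputable def Q (j : ℕ) : ℝ := ∏ l ∈ Finset.range j, (1 - (2:ℝ)^(-(l:ℤ)-1))

/-- `Q_∞ = ∏_{ℓ≥1} (1 - 2^{-ℓ})`. -/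
noncomputable def Qinf : ℝ := ∏' l : ℕ, (1 - (2:ℝ)^(-(l:ℤ)-1))

/-- Expected external profile `μ_{n,k}`. -/
noncomputable def mu : ℕ → ℕ → ℝ
  | n, 0 => if n = 0 then 1 else 0
  | n, k + 1 => (2:ℝ)^((2:ℤ) - (n:ℤ)) *
      ∑ j ∈ Finset.range n, ((n-1).choose j : ℝ) * mu j k

/-- Second moment `ν_{n,k}` of the external profile. -/
noncomputable def nu : ℕ → ℕ → ℝ
  | n, 0 => if n = 0 then 1 else 0
  | n, k + 1 => (2:ℝ)^((2:ℤ) - (n:ℤ)) *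
      (∑ j ∈ Finset.range n, ((n-1).choose j : ℝ) * nu j k)
    + (2:ℝ)^((2:ℤ) - (n:ℤ)) *
      (∑ j ∈ Finset.range n, ((n-1).choose j : ℝ) * mu j k * mu (n-1-j) k)

/-- `φ(u,v;x) = e^{-ux} ∫_0^x t e^{(u-v)t} dt`. -/
noncomputable def phi (u v x : ℝ) : ℝ :=
  Real.exp (-u * x) * ∫ t in (0:ℝ)..x, t * Real.exp ((u - v) * t)

/-- The function `G` describing the asymptotic variance of the external profile. -/
noncomputable def G (x : ℝ) : ℝ :=
  ∑' j : ℕ, ∑' r : ℕ, ∑ h ∈ Finset.range (j+1), ∑ l ∈ Finset.range (j+1),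
    (-1:ℝ)^(r+h+l) *
      (2:ℝ)^(-(j:ℤ) - (r.choose 2 : ℤ) - (h.choose 2 : ℤ) - (l.choose 2 : ℤ)
        + 2*(h:ℤ) + 2*(l:ℤ)) *
      phi ((2:ℝ)^(r+j)) ((2:ℝ)^h + (2:ℝ)^l) x /
      (Qinf * Q r * Q h * Q (j-h) * Q l * Q (j-l))

lemma Q_zero : Q 0 = 1 := by simp [Q]

lemma Q_succ (j : ℕ) : Q (j+1) = Q j * (1 - 1/2^(j+1)) := by
  unfold Q
  rw [Finset.prod_range_succ]
  congr 2
  rw [show (-(j:ℤ)-1) = -((j+1:ℕ):ℤ) by push_cast; ring, zpow_neg, zpow_natCast, one_div]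

lemma Q_lower (j : ℕ) : 1/4 + 1/2^(j+2) ≤ Q (j+1) := by
  induction j with
  | zero => rw [Q_succ, Q_zero]; norm_num
  | succ j ih =>
    rw [Q_succ]
    have h1 : (0:ℝ) < 1/2^(j+2) := by positivity
    have h2 : (1:ℝ)/2^(j+2) ≤ 1/4 := by
      rw [pow_add]
      have : (1:ℝ) ≤ 2^j := one_le_pow₀ (by norm_num)
      rw [div_le_div_iff₀ (by positivity) (by norm_num)]; linarith
    have h3 : (1:ℝ)/2^(j+1+2) = 1/2^(j+2)/2 := by
      rw [show j+1+2 = (j+2)+1 by ring, pow_succ _ (j+2), div_div]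
    rw [h3, show j+1+1 = j+2 from rfl]
    set x := (1:ℝ)/2^(j+2)
    have h4 : (1/4 + x) * (1-x) ≤ Q (j+1) * (1-x) := by
      apply mul_le_mul_of_nonneg_right ih; linarith
    nlinarith

lemma Q_ge (j : ℕ) : 1/4 ≤ Q j := by
  rcases j with _ | j
  · rw [Q_zero]; norm_num
  · have := Q_lower j
    have h1 : (0:ℝ) < 1/2^(j+2) := by positivity
    linarith

lemma Q_pos (j : ℕ) : 0 < Q j := by linarith [Q_ge j]
lemma Q_ne (j : ℕ) : Q j ≠ 0 := (Q_pos j).ne'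

lemma one_sub_ne (j : ℕ) : (1 - 1/2^(j+1) : ℝ) ≠ 0 := by
  intro h
  have := Q_ne (j+1)
  rw [Q_succ, h] at this
  simp at this

lemma Q_anti : Antitone Q := by
  apply antitone_nat_of_succ_le
  intro j
  rw [Q_succ]
  have h1 : (0:ℝ) < 1/2^(j+1) := by positivity
  nlinarith [Q_pos j]

lemma Q_le_one (j : ℕ) : Q j ≤ 1 := by
  rw [← Q_zero]; exact Q_anti (Nat.zero_le j)

lemma Q_mono' : Monotone (fun j => Q j - 1/2^j) := by
  apply monotone_nat_of_le_succ
  intro j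
  show Q j - 1/2^j ≤ Q (j+1) - 1/2^(j+1)
  rw [Q_succ]
  have h1 : (0:ℝ) < 1/2^(j+1) := by positivity
  have h2 : (1:ℝ)/2^j = 2 * (1/2^(j+1)) := by rw [pow_succ]; field_simp
  rw [h2]
  nlinarith [Q_le_one j]

lemma Q_tendsto : Tendsto Q atTop (nhds Qinf) := by
  have hs : Summable (fun l : ℕ => -(2:ℝ)^(-(l:ℤ)-1)) := by
    apply Summable.neg
    have : (fun l : ℕ => (2:ℝ)^(-(l:ℤ)-1)) = fun l : ℕ => (1/2:ℝ)^l * (1/2) := by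
      ext l
      rw [zpow_sub₀ (by norm_num), zpow_neg, zpow_natCast]
      simp [div_eq_mul_inv]
    rw [this]
    exact summable_geometric_two.mul_right _
  have hm := Real.multipliable_one_add_of_summable hs
  have := hm.hasProd.tendsto_prod_nat
  simp only [← sub_eq_add_neg] at this
  exact this

lemma Qinf_le (m : ℕ) : Qinf ≤ Q m := Q_anti.le_of_tendsto Q_tendsto m

lemma Qinf_ge : 1/4 ≤ Qinf := ge_of_tendsto' Q_tendsto Q_ge
lemma Qinf_pos : 0 < Qinf := by linarith [Qinf_ge]

lemma Q_sub_le (m : ℕ) : Q m - Qinf ≤ 1/2^m := by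
  have h : Tendsto (fun j => Q j - 1/2^j) atTop (nhds (Qinf - 0)) := by
    apply Q_tendsto.sub
    have := tendsto_pow_atTop_nhds_zero_of_lt_one (r := (1/2:ℝ)) (by norm_num) (by norm_num)
    simpa [one_div] using this
  have := Q_mono'.ge_of_tendsto h m
  beta_reduce at this
  linarith

lemma invQ_diff (m : ℕ) : |1/Q m - 1/Qinf| ≤ 16/2^m := by
  have h1 := Q_ge m
  have h2 := Qinf_ge
  have h3 := Q_sub_le m
  have h4 := Qinf_le m
  rw [div_sub_div _ _ (Q_ne m) Qinf_pos.ne', abs_div, abs_of_nonpos (by linarith),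
    abs_of_pos (mul_pos (Q_pos m) Qinf_pos), div_le_iff₀ (mul_pos (Q_pos m) Qinf_pos)]
  have h5 : 1/16 ≤ Q m * Qinf := by nlinarith
  have h6 : (0:ℝ) < 1/2^m := by positivity
  calc _ ≤ (1:ℝ)/2^m := by linarith
    _ = 16 * (1/2^m) * (1/16) := by ring
    _ ≤ 16 * (1/2^m) * (Q m * Qinf) := by gcongr
    _ = _ := by ring

/-- weights -/
noncomputable def ww (h : ℕ) : ℝ := (-1)^h * (1/2^(h.choose 2)) / Q h

lemma ww_zero : ww 0 = 1 := by simp [ww, Q_zero]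

lemma ww_partial (s t : ℕ) : ∑ h ∈ Finset.range (s+1), ww h / Q (s+t+1-h) =
    (-1)^s * (1/2^((s+1).choose 2)) / (Q s * Q t * (1 - 1/2^(s+t+1))) := by
  induction s generalizing t with
  | zero =>
    simp only [zero_add, Finset.sum_range_one, ww_zero, Nat.sub_zero, Q_succ, Q_zero]
    simp
  | succ s ih =>
    rw [Finset.sum_range_succ]
    have := ih (t+1)
    rw [show s + (t+1) + 1 = s+1+t+1 by ring] at this
    rw [this, show s+1+t+1-(s+1) = t+1 by omega]
    have e : (s+1+1).choose 2 = (s+1).choose 2 + (s+1) := by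
      rw [Nat.choose_succ_succ' (s+1) 1]; simp; ring
    rw [ww, e, Q_succ, Q_succ]
    have h1 := one_sub_ne s
    have h2 := one_sub_ne t
    have h3 := one_sub_ne (s+1+t)
    have h4 := Q_ne s
    have h5 := Q_ne t
    have e3 : (1:ℝ)/2^(s+1+t+1) = (1/2^(s+1)) * (1/2^(t+1)) := by
      rw [show s+1+t+1 = (s+1)+(t+1) by ring, pow_add]; field_simp
    have e4 : (1:ℝ)/2^((s+1).choose 2 + (s+1)) = (1/2^((s+1).choose 2)) * (1/2^(s+1)) := by
      rw [pow_add]; field_simp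
    rw [e4, pow_succ (-1:ℝ) s]
    rw [e3] at h3 ⊢
    generalize (1:ℝ)/2^(s+1) = X at *
    generalize (1:ℝ)/2^(t+1) = Y at *
    generalize (1:ℝ)/2^((s+1).choose 2) = Z at *
    have h6 : 1 - Y*X ≠ 0 := by rwa [mul_comm]
    field_simp
    ring

lemma ww_sum (m : ℕ) : ∑ h ∈ Finset.range (m+2), ww h / Q (m+1-h) = 0 := by
  rw [Finset.sum_range_succ]
  have := ww_partial m 0
  rw [add_zero] at this
  rw [this, Nat.sub_self, Q_zero, ww, Q_succ]
  have h1 := one_sub_ne m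
  have h4 := Q_ne m
  rw [pow_succ (-1:ℝ) m]
  field_simp
  ring

noncomputable def bin (f : ℕ → ℝ) (n : ℕ) : ℝ :=
  (∑ j ∈ Finset.range (n+1), (n.choose j : ℝ) * f j) / 2^n

lemma bin_zero (f : ℕ → ℝ) : bin f 0 = f 0 := by simp [bin]

lemma bin_succ (f : ℕ → ℝ) (n : ℕ) :
    bin f (n+1) = (bin f n + bin (fun j => f (j+1)) n) / 2 := by
  unfold bin
  have := Finset.sum_choose_succ_mul (fun i _ => f i) n
  beta_reduce at this
  rw [this, pow_succ]
  field_simp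

lemma bin_add (f g : ℕ → ℝ) (n : ℕ) : bin (fun j => f j + g j) n = bin f n + bin g n := by
  unfold bin
  rw [← add_div, ← Finset.sum_add_distrib]
  congr 1
  exact Finset.sum_congr rfl fun _ _ => by ring

lemma bin_mul (c : ℝ) (f : ℕ → ℝ) (n : ℕ) : bin (fun j => c * f j) n = c * bin f n := by
  unfold bin
  rw [← mul_div_assoc, Finset.mul_sum]
  congr 1
  exact Finset.sum_congr rfl fun _ _ => by ring

lemma bin_sum (s : Finset ℕ) (f : ℕ → ℕ → ℝ) (n : ℕ) :
    bin (fun j => ∑ i ∈ s, f i j) n = ∑ i ∈ s, bin (f i) n := by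
  unfold bin
  rw [← Finset.sum_div]
  congr 1
  rw [Finset.sum_comm]
  exact Finset.sum_congr rfl fun _ _ => by rw [Finset.mul_sum]

lemma bin_pow (y : ℝ) (n : ℕ) : bin (fun j => y^j) n = ((1+y)/2)^n := by
  induction n with
  | zero => simp [bin_zero]
  | succ n ih =>
    rw [bin_succ]
    simp only [pow_succ' y]
    rw [bin_mul, ih]
    ring

lemma dpow_succ (y : ℝ) (j : ℕ) :
    ((j+1:ℕ):ℝ) * y^(j+1-1) = y * ((j:ℝ) * y^(j-1)) + y^j := by
  rcases j with _ | j
  · simp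
  · simp only [Nat.add_sub_cancel]; push_cast; ring

lemma bin_dpow (y : ℝ) (n : ℕ) :
    bin (fun j => (j:ℝ) * y^(j-1)) n = (n:ℝ)/2 * ((1+y)/2)^(n-1) := by
  induction n with
  | zero => simp [bin_zero]
  | succ n ih =>
    rw [bin_succ]
    simp only [dpow_succ]
    rw [bin_add, bin_mul, ih, bin_pow]
    have := dpow_succ ((1+y)/2) n
    have h2 : ((n+1:ℕ):ℝ)/2 * ((1+y)/2)^(n+1-1) = (((n+1:ℕ):ℝ) * ((1+y)/2)^(n+1-1))/2 := by ring
    rw [h2, this]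
    ring

noncomputable def phd (u v : ℝ) : ℕ → ℝ
  | 0 => 0
  | n+1 => (1-u) * phd u v n + n * (1-v)^(n-1)

lemma bin_phd (u v : ℝ) (n : ℕ) : bin (phd u v) n = phd (u/2) (v/2) n / 4 := by
  induction n with
  | zero => simp [bin_zero, phd]
  | succ n ih =>
    rw [bin_succ]
    simp only [phd]
    rw [bin_add, bin_mul, ih, bin_dpow]
    rw [show (1+(1-v))/2 = 1-v/2 by ring]
    ring

lemma zpow_aux (n : ℕ) : (2:ℝ)^((2:ℤ) - ((n+1:ℕ):ℤ)) = 2 * (1/2^n) := by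
  rw [show (2:ℤ) - ((n+1:ℕ):ℤ) = 1 - (n:ℤ) by push_cast; ring, zpow_sub₀ (by norm_num),
    zpow_natCast]
  simp [div_eq_mul_inv]

lemma mu_succ (n k : ℕ) : mu (n+1) (k+1) = 2 * bin (fun j => mu j k) n := by
  rw [mu, zpow_aux, bin]
  simp only [Nat.add_sub_cancel]
  ring

lemma nu_succ (n k : ℕ) : nu (n+1) (k+1) = 2 * bin (fun j => nu j k) n +
    2 * bin (fun j => mu j k * mu (n-j) k) n := by
  rw [nu, zpow_aux, bin, bin]
  simp only [Nat.add_sub_cancel, mul_assoc]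
  ring

noncomputable def cf (k h : ℕ) : ℝ := 2^k * (ww h / Q (k-h))
noncomputable def al (k h : ℕ) : ℝ := 2^h/2^k

lemma al_self (k : ℕ) : al k k = 1 := by simp [al]

lemma al_succ (k h : ℕ) : al (k+1) h = al k h / 2 := by
  unfold al; rw [pow_succ]; field_simp

lemma al_eq {k h : ℕ} (hh : h ≤ k) : al k h = 1/2^(k-h) := by
  unfold al
  rw [div_eq_div_iff (by positivity) (by positivity), one_mul, ← pow_add]
  congr 1; omega

lemma Q_al {k h : ℕ} (hh : h ≤ k) : (1 - al (k+1) h) / Q (k+1-h) = 1 / Q (k-h) := by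
  rw [al_eq (by omega), show k+1-h = (k-h)+1 by omega, Q_succ]
  rw [mul_comm (Q (k-h)), ← div_div, div_self (one_sub_ne (k-h))]

lemma cf_succ {k h : ℕ} (hh : h ≤ k) : cf (k+1) h * (1 - al (k+1) h) = 2 * cf k h := by
  unfold cf
  have := Q_al hh
  calc _ = 2^(k+1) * ww h * ((1 - al (k+1) h) / Q (k+1-h)) := by ring
    _ = _ := by rw [this]; ring

lemma cf_sum (k : ℕ) : ∑ h ∈ Finset.range (k+1), cf k h = if k = 0 then 1 else 0 := by
  unfold cf
  rw [← Finset.mul_sum]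
  rcases k with _ | k
  · simp [ww_zero, Q_zero]
  · rw [ww_sum]; simp

/-- summing against level k+1 with factor -/
lemma cf_shift (k : ℕ) (f : ℕ → ℝ) :
    ∑ h ∈ Finset.range (k+2), cf (k+1) h * ((1 - al (k+1) h) * f h) =
      2 * ∑ h ∈ Finset.range (k+1), cf k h * f h := by
  rw [Finset.sum_range_succ, al_self, Finset.mul_sum]
  simp only [sub_self, zero_mul, mul_zero, add_zero]
  apply Finset.sum_congr rfl
  intro h hh
  rw [← mul_assoc, cf_succ (by simpa [Nat.lt_succ_iff] using hh)]
  ring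

lemma mu_eq (n k : ℕ) : mu n k = ∑ h ∈ Finset.range (k+1), cf k h * (1 - al k h)^n := by
  induction k generalizing n with
  | zero =>
    rcases n with _ | n <;> simp [mu, cf, al, ww_zero, Q_zero]
  | succ k ih =>
    rcases n with _ | n
    · simp [mu, cf_sum]
    · rw [mu_succ]
      simp only [ih]
      rw [bin_sum]
      simp only [pow_succ']
      rw [cf_shift]
      congr 1
      apply Finset.sum_congr rfl
      intro h _
      rw [bin_mul, bin_pow, al_succ]
      congr 2; ring

lemma bin_conv (y y' : ℝ) (n : ℕ) : bin (fun j => y^j * y'^(n-j)) n = ((y+y')/2)^n := by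
  unfold bin
  rw [div_pow, add_pow]
  congr 1
  exact Finset.sum_congr rfl fun _ _ => by ring

lemma mumu (n k : ℕ) : bin (fun j => mu j k * mu (n-j) k) n =
    ∑ h ∈ Finset.range (k+1), cf k h * ∑ l ∈ Finset.range (k+1), cf k l *
      (1 - al (k+1) h - al (k+1) l)^n := by
  simp only [mu_eq, Finset.sum_mul_sum]
  rw [bin_sum]
  apply Finset.sum_congr rfl
  intro h _
  rw [bin_sum, Finset.mul_sum]
  apply Finset.sum_congr rfl
  intro l _
  have : (fun j => cf k h * (1 - al k h)^j * (cf k l * (1 - al k l)^(n-j))) =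
      fun j => (cf k h * cf k l) * ((1 - al k h)^j * (1 - al k l)^(n-j)) := by
    ext j; ring
  rw [this, bin_mul, bin_conv, al_succ, al_succ, mul_assoc]
  congr 3; ring

noncomputable def II (j : ℕ) (V : ℝ) (k n : ℕ) : ℝ :=
  ∑ r ∈ Finset.range (k-j+1), ww r / Q (k-j-r) * phd (al k (r+j)) (V/2^k) n

lemma II_succ {j k : ℕ} (hj : j ≤ k) (V : ℝ) (n : ℕ) :
    II j V (k+1) (n+1) = 4 * bin (II j V k) n := by
  have e : (II j V k) = fun n => ∑ r ∈ Finset.range (k-j+1), ww r / Q (k-j-r) * phd (al k (r+j)) (V/2^k) n := by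
    ext n; rfl
  rw [e, bin_sum, II]
  simp only [phd, mul_add, Finset.sum_add_distrib]
  rw [← Finset.sum_mul, show k+1-j = (k-j)+1 by omega, ww_sum, zero_mul, add_zero,
    Finset.sum_range_succ, show k-j+1+j = k+1 by omega, al_self]
  simp only [sub_self, zero_mul, mul_zero, add_zero]
  rw [Finset.mul_sum]
  apply Finset.sum_congr rfl
  intro r hr
  have hr' : r + j ≤ k := by
    have := Finset.mem_range.1 hr; omega
  rw [bin_mul, bin_phd]
  have := Q_al hr'
  rw [show k+1-(r+j) = k-j+1-r by omega, show k-(r+j) = k-j-r by omega] at this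
  rw [← al_succ, div_div, ← pow_succ]
  calc _ = ww r * ((1 - al (k+1) (r+j)) / Q (k-j+1-r)) * phd (al (k+1) (r+j)) (V/2^(k+1)) n := by ring
    _ = _ := by rw [this]; ring

lemma II_self (V : ℝ) (k n : ℕ) : II k V k (n+1) = n * (1 - V/2^k)^(n-1) := by
  simp [II, ww_zero, Q_zero, al_self, phd]

noncomputable def Th (j h l : ℕ) : ℝ := ww h * 4^h / Q (j-h) * (ww l * 4^l / Q (j-l))

noncomputable def AA (n k : ℕ) : ℝ :=
  2^k/4^k * ∑ j ∈ Finset.range (k+1), 1/2^j * ∑ h ∈ Finset.range (j+1), ∑ l ∈ Finset.range (j+1),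
    Th j h l * II j (2^h+2^l) k n

noncomputable def RB (n k : ℕ) : ℝ :=
  ∑ h ∈ Finset.range (k+1), cf k h * ∑ l ∈ Finset.range (k+1), cf k l *
    ((1 - al k h - al k l)^n + n * (al k h * al k l) * (1 - al k h - al k l)^(n-1))

lemma AA_zero (k : ℕ) : AA 0 k = 0 := by
  simp [AA, II, phd]

lemma RB_zero (k : ℕ) : RB 0 k = if k = 0 then 1 else 0 := by
  simp [RB, cf_sum]

lemma Th_cf (k h l : ℕ) : 1/4^k * Th k h l = cf k h * cf k l * (al k h * al k l)^2 := by
  unfold Th cf al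
  have : (4:ℝ) = 2^2 := by norm_num
  rw [this]
  simp only [← pow_mul, mul_comm 2]
  simp only [pow_mul]
  have := Q_ne (k-h)
  have := Q_ne (k-l)
  field_simp

lemma AA_succ (n k : ℕ) : AA (n+1) (k+1) = 2 * bin (fun j => AA j k) n +
    ∑ h ∈ Finset.range (k+2), cf (k+1) h * ∑ l ∈ Finset.range (k+2), cf (k+1) l *
      ((al (k+1) h * al (k+1) l)^2 * (n * (1 - al (k+1) h - al (k+1) l)^(n-1))) := by
  unfold AA
  rw [Finset.sum_range_succ, mul_add, bin_mul, bin_sum]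
  congr 1
  · rw [show (2:ℝ)^(k+1)/4^(k+1) = 2^k/4^k/2 by rw [pow_succ, pow_succ]; field_simp; norm_num]
    rw [div_mul_eq_mul_div, mul_div_assoc, ← mul_assoc, mul_comm 2 (2^k/4^k : ℝ), mul_assoc]
    congr 1
    rw [Finset.sum_div, Finset.mul_sum]
    apply Finset.sum_congr rfl
    intro j hj
    have hj' : j ≤ k := by
      have := Finset.mem_range.1 hj; omega
    rw [bin_mul, bin_sum, mul_div_assoc, mul_left_comm]
    congr 1
    rw [Finset.sum_div, Finset.mul_sum]
    apply Finset.sum_congr rfl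
    intro h _
    rw [bin_sum, Finset.sum_div, Finset.mul_sum]
    apply Finset.sum_congr rfl
    intro l _
    rw [bin_mul, II_succ hj']
    ring
  · rw [← mul_assoc, show (2:ℝ)^(k+1)/4^(k+1)*(1/2^(k+1)) = 1/4^(k+1) by field_simp, Finset.mul_sum]
    apply Finset.sum_congr rfl
    intro h _
    rw [Finset.mul_sum, Finset.mul_sum]
    apply Finset.sum_congr rfl
    intro l _
    rw [II_self, ← mul_assoc, Th_cf, show (1 - ((2:ℝ)^h+2^l)/2^(k+1)) = 1 - al (k+1) h - al (k+1) l by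
      unfold al; ring]
    ring

lemma RB_succ (n k : ℕ) : RB (n+1) (k+1) +
    ∑ h ∈ Finset.range (k+2), cf (k+1) h * ∑ l ∈ Finset.range (k+2), cf (k+1) l *
      ((al (k+1) h * al (k+1) l)^2 * (n * (1 - al (k+1) h - al (k+1) l)^(n-1))) =
    2 * bin (fun j => RB j k) n + 2 * bin (fun j => mu j k * mu (n-j) k) n := by
  have L : RB (n+1) (k+1) +
    ∑ h ∈ Finset.range (k+2), cf (k+1) h * ∑ l ∈ Finset.range (k+2), cf (k+1) l *
      ((al (k+1) h * al (k+1) l)^2 * (n * (1 - al (k+1) h - al (k+1) l)^(n-1))) =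
      ∑ h ∈ Finset.range (k+2), cf (k+1) h * ((1 - al (k+1) h) *
        ∑ l ∈ Finset.range (k+2), cf (k+1) l * ((1 - al (k+1) l) *
        ((1 - al (k+1) h - al (k+1) l)^n +
          al (k+1) h * al (k+1) l * (n * (1 - al (k+1) h - al (k+1) l)^(n-1))))) := by
    unfold RB
    rw [← Finset.sum_add_distrib]
    apply Finset.sum_congr rfl
    intro h _
    rw [← mul_add, ← Finset.sum_add_distrib, Finset.mul_sum (a := cf (k+1) h),
      Finset.mul_sum (a := 1 - al (k+1) h), Finset.mul_sum (a := cf (k+1) h)]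
    apply Finset.sum_congr rfl
    intro l _
    have := dpow_succ (1 - al (k+1) h - al (k+1) l) n
    rw [mul_right_comm (((n+1:ℕ):ℝ)), this]
    ring
  rw [L, cf_shift]
  simp only [cf_shift]
  rw [mumu]
  unfold RB
  rw [bin_sum, ← mul_add, ← Finset.sum_add_distrib]
  congr 1
  apply Finset.sum_congr rfl
  intro h _
  rw [bin_mul, ← mul_add, bin_sum, ← Finset.sum_add_distrib, Finset.mul_sum]
  congr 1
  apply Finset.sum_congr rfl
  intro l _
  rw [bin_mul, bin_add, bin_pow]
  have : (fun j : ℕ => (j:ℝ) * (al k h * al k l) * (1 - al k h - al k l)^(j-1)) =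
    fun j : ℕ => (al k h * al k l) * ((j:ℝ) * (1 - al k h - al k l)^(j-1)) := by ext j; ring
  rw [this, bin_mul, bin_dpow, al_succ, al_succ,
    show (1 + (1 - al k h - al k l))/2 = 1 - al k h / 2 - al k l / 2 by ring]
  ring

lemma nu_eq (n k : ℕ) : nu n k = AA n k + RB n k := by
  induction k generalizing n with
  | zero =>
    rcases n with _ | n
    · rw [AA_zero, RB_zero]; simp [nu]
    · simp only [nu, AA, II, RB]
      rcases n with _ | n
      · simp [Th, ww_zero, Q_zero, cf, al, phd]
      · simp [Th, ww_zero, Q_zero, cf, al, phd]; ring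
  | succ k ih =>
    rcases n with _ | n
    · rw [AA_zero, RB_zero]; simp [nu]
    · rw [nu_succ]
      simp only [ih]
      rw [bin_add, AA_succ]
      have := RB_succ n k
      linarith


lemma phi_nonneg {u v x : ℝ} (hx : 0 ≤ x) : 0 ≤ phi u v x := by
  unfold phi
  apply mul_nonneg (Real.exp_pos _).le
  apply intervalIntegral.integral_nonneg hx
  intro t ht
  exact mul_nonneg ht.1 (Real.exp_pos _).le

lemma t_exp_le {v t : ℝ} (hv : 0 < v) : t * Real.exp (-(v*t)) ≤ 1/v := by
  have h1 := Real.add_one_le_exp (v*t)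
  rw [Real.exp_neg, ← div_eq_mul_inv, div_le_div_iff₀ (Real.exp_pos _) hv]
  linarith

lemma phi_le {u v x : ℝ} (hu : 0 < u) (hv : 0 < v) (hx : 0 ≤ x) : phi u v x ≤ 1/(u*v) := by
  unfold phi
  have h1 : ∫ t in (0:ℝ)..x, t * Real.exp ((u-v)*t) ≤ ∫ t in (0:ℝ)..x, 1/v * Real.exp (u*t) := by
    apply intervalIntegral.integral_mono_on hx
    · exact Continuous.intervalIntegrable (by fun_prop) _ _
    · exact Continuous.intervalIntegrable (by fun_prop) _ _
    · intro t _
      have : Real.exp ((u-v)*t) = Real.exp (-(v*t)) * Real.exp (u*t) := by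
        rw [← Real.exp_add]; congr 1; ring
      rw [this, ← mul_assoc]
      exact mul_le_mul_of_nonneg_right (t_exp_le hv) (Real.exp_pos _).le
  have h2 : ∫ t in (0:ℝ)..x, 1/v * Real.exp (u*t) = 1/v * ((Real.exp (u*x) - 1)/u) := by
    rw [intervalIntegral.integral_const_mul, intervalIntegral.integral_comp_mul_left _ hu.ne',
      integral_exp]
    simp [div_eq_inv_mul]
  rw [h2] at h1
  calc _ ≤ Real.exp (-u*x) * (1/v * ((Real.exp (u*x) - 1)/u)) :=
        mul_le_mul_of_nonneg_left h1 (Real.exp_pos _).le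
    _ = (Real.exp (-u*x) * Real.exp (u*x) - Real.exp (-u*x)) * (1/(u*v)) := by
        field_simp
    _ = (1 - Real.exp (-u*x)) * (1/(u*v)) := by
        rw [← Real.exp_add]; simp
    _ ≤ 1 * (1/(u*v)) := by
        apply mul_le_mul_of_nonneg_right _ (by positivity)
        linarith [Real.exp_pos (-u*x)]
    _ = _ := one_mul _

lemma phi_step (u v : ℝ) (n : ℕ) : phi u v ((n+1:ℕ):ℝ) = Real.exp (-u) * phi u v n +
    ∫ t in (n:ℝ)..(n+1:ℕ), t * Real.exp (-(v*t)) * Real.exp (-(u*(n+1-t))) := by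
  unfold phi
  rw [← intervalIntegral.integral_add_adjacent_intervals (b := (n:ℝ))
    (Continuous.intervalIntegrable (by fun_prop) _ _) (Continuous.intervalIntegrable (by fun_prop) _ _),
    mul_add, ← mul_assoc, ← Real.exp_add]
  congr 1
  · congr 2; push_cast; ring
  · rw [← intervalIntegral.integral_const_mul]
    apply intervalIntegral.integral_congr
    intro t _
    beta_reduce
    rw [mul_left_comm, mul_assoc, ← Real.exp_add, ← Real.exp_add]
    congr 2; push_cast; ring

lemma sq_exp_le {s : ℝ} (hs : 0 ≤ s) : s^2 * Real.exp (-s) ≤ 2 := by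
  have h1 := Real.quadratic_le_exp_of_nonneg hs
  rw [Real.exp_neg, ← div_eq_mul_inv, div_le_iff₀ (Real.exp_pos _)]
  linarith

lemma dp_bound {v : ℝ} (hv : 0 < v) (hv2 : v ≤ 3/2) (n : ℕ) :
    |(n:ℝ) * Real.exp (-(v*n)) - n * (1-v)^(n-1)| ≤ 18 := by
  have hE1 : Real.exp 1 < 3 := by linarith [Real.exp_one_lt_d9]
  rcases n with _ | m
  · simp
  rw [Nat.add_sub_cancel, ← mul_sub, abs_mul, abs_of_nonneg (by positivity)]
  have hx : Real.exp (-(v*((m+1:ℕ):ℝ))) = Real.exp (-v)^(m+1) := by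
    rw [← Real.exp_nat_mul]; congr 1; ring
  by_cases h1 : v ≤ 1
  · have hy0 : 0 ≤ 1 - v := by linarith
    have hyE : 1 - v ≤ Real.exp (-v) := by linarith [Real.add_one_le_exp (-v)]
    have hE : Real.exp (-v) ≤ 1 := by rw [Real.exp_le_one_iff]; linarith
    have hEp := Real.exp_pos (-v)
    have hev : Real.exp v ≤ 3 := (Real.exp_le_exp.2 h1).trans hE1.le
    have hdiff : Real.exp (-v) - (1-v) ≤ v^2 := by
      have := Real.abs_exp_sub_one_sub_id_le (x := -v) (by rw [abs_neg, abs_of_pos hv]; exact h1)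
      have := (abs_le.1 this).2
      nlinarith
    have hs : (0:ℝ) ≤ v*((m+1:ℕ):ℝ) := by positivity
    rw [hx]
    have key1 : ((m+1:ℕ):ℝ) * (Real.exp (-v)^(m+1) - (1-v)^m) ≤ 18 := by
      rcases m with _ | m
      · simp; linarith
      have hp : Real.exp (-v)^(m+1+1) ≤ Real.exp (-v)^(m+1) := pow_le_pow_of_le_one hEp.le hE (by omega)
      have hq := abs_pow_sub_pow_le (Real.exp (-v)) (1-v) (m+1)
      rw [abs_of_nonneg (a := Real.exp (-v) - (1-v)) (by linarith), abs_of_nonneg hEp.le, abs_of_nonneg hy0,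
        max_eq_left hyE, Nat.add_sub_cancel] at hq
      have hq := (abs_le.1 hq).2
      have h2 := sq_exp_le hs
      have e2 : Real.exp (-v)^m = Real.exp (-(v*((m+1+1:ℕ):ℝ))) * Real.exp v * Real.exp v := by
        rw [← Real.exp_nat_mul, ← Real.exp_add, ← Real.exp_add]; congr 1; push_cast; ring
      calc _ ≤ ((m+1+1:ℕ):ℝ) * (v^2 * ((m+1+1:ℕ):ℝ) * Real.exp (-v)^m) := by
            apply mul_le_mul_of_nonneg_left _ (by positivity)
            calc _ ≤ (Real.exp (-v) - (1-v)) * ((m+1:ℕ):ℝ) * Real.exp (-v)^m := by linarith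
              _ ≤ _ := by gcongr; omega
        _ = ((v*((m+1+1:ℕ):ℝ))^2 * Real.exp (-(v*((m+1+1:ℕ):ℝ)))) * (Real.exp v * Real.exp v) := by
            rw [e2]; ring
        _ ≤ 2 * (3*3) := by gcongr
        _ = 18 := by norm_num
    have key2 : ((m+1:ℕ):ℝ) * ((1-v)^m - Real.exp (-v)^(m+1)) ≤ 18 := by
      have h3 : (1-v)^m ≤ Real.exp (-v)^m := pow_le_pow_left₀ hy0 hyE m
      have h4 : (1-v)^m - Real.exp (-v)^(m+1) ≤ Real.exp (-v)^m * v := by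
        rw [pow_succ]
        have : 0 < Real.exp (-v)^m := by positivity
        nlinarith
      have e2 : Real.exp (-v)^m = Real.exp (-(v*((m+1:ℕ):ℝ))) * Real.exp v := by
        rw [← Real.exp_nat_mul, ← Real.exp_add]; congr 1; push_cast; ring
      have h5 := t_exp_le (t := ((m+1:ℕ):ℝ)) hv
      rw [le_div_iff₀ hv] at h5
      calc _ ≤ ((m+1:ℕ):ℝ) * (Real.exp (-v)^m * v) := by gcongr
        _ = (((m+1:ℕ):ℝ) * Real.exp (-(v*((m+1:ℕ):ℝ))) * v) * Real.exp v := by rw [e2]; ring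
        _ ≤ 1 * 3 := by gcongr
        _ ≤ 18 := by norm_num
    rw [← abs_of_nonneg (a := ((m+1:ℕ):ℝ)) (by positivity), ← abs_mul, abs_le]
    constructor <;> linarith
  · push Not at h1
    have h5 := t_exp_le (t := ((m+1:ℕ):ℝ)) hv
    have h6 : 1/v ≤ 1 := by rw [div_le_one hv]; linarith
    have h7 : |(1-v)^m| ≤ (1/2)^m := by
      rw [abs_pow]; apply pow_le_pow_left₀ (abs_nonneg _); rw [abs_le]; constructor <;> linarith
    have h8 : ((m+1:ℕ):ℝ) * (1/2)^m ≤ 2 := by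
      have : ((m+1:ℕ):ℝ) ≤ 2^(m+1) := by exact_mod_cast (Nat.lt_two_pow_self (n := m+1)).le
      calc _ ≤ (2:ℝ)^(m+1) * (1/2)^m := by gcongr
        _ = 2 := by rw [pow_succ, mul_right_comm, ← mul_pow]; norm_num
    calc _ ≤ ((m+1:ℕ):ℝ) * (|Real.exp (-(v*((m+1:ℕ):ℝ)))| + |(1-v)^m|) := by
          gcongr; exact abs_sub _ _
      _ ≤ ((m+1:ℕ):ℝ) * (Real.exp (-(v*((m+1:ℕ):ℝ))) + (1/2)^m) := by
          rw [abs_of_pos (Real.exp_pos _)]; gcongr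
      _ ≤ 18 := by rw [mul_add]; linarith

lemma step_bound {u v : ℝ} (hu : 0 < u) (hv : 0 < v) (hv2 : v ≤ 3/2) (n : ℕ) :
    |(n:ℝ) * (1-v)^(n-1) -
      ∫ t in (n:ℝ)..(n+1:ℕ), t * Real.exp (-(v*t)) * Real.exp (-(u*(n+1-t)))| ≤ 20 + u/v := by
  have e : (n:ℝ) * (1-v)^(n-1) = ∫ t in (n:ℝ)..(n+1:ℕ), (n:ℝ) * (1-v)^(n-1) := by simp
  rw [e, ← intervalIntegral.integral_sub (Continuous.intervalIntegrable (by fun_prop) _ _)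
    (Continuous.intervalIntegrable (by fun_prop) _ _)]
  have := intervalIntegral.norm_integral_le_of_norm_le_const (a := (n:ℝ)) (b := ((n+1:ℕ):ℝ))
    (C := 20 + u/v) (f := fun t => (n:ℝ) * (1-v)^(n-1) - t * Real.exp (-(v*t)) * Real.exp (-(u*(n+1-t)))) ?_
  · simpa using this
  intro t ht
  rw [Set.uIoc_of_le (by simp)] at ht
  obtain ⟨ht1, ht2⟩ := ht
  push_cast at ht2
  have hn0 : (0:ℝ) ≤ n := by positivity
  have ht0 : 0 ≤ t := by linarith
  have d := dp_bound hv hv2 n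
  have g1 := t_exp_le (t := t) hv
  have g2 := t_exp_le (t := (n:ℝ)) hv
  rw [le_div_iff₀ hv] at g2
  have hEt := Real.exp_pos (-(v*t))
  have hEn := Real.exp_pos (-(v*n))
  have p1 : 1 - Real.exp (-(u*(n+1-t))) ≤ u := by
    have := Real.add_one_le_exp (-(u*(n+1-t)))
    nlinarith
  have p2 : Real.exp (-(u*(n+1-t))) ≤ 1 := by
    rw [Real.exp_le_one_iff]
    have : 0 ≤ u*(n+1-t) := mul_nonneg hu.le (by linarith)
    linarith
  have b1 : |t * Real.exp (-(v*t)) - t * Real.exp (-(v*t)) * Real.exp (-(u*(n+1-t)))| ≤ u/v := by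
    rw [← mul_one_sub, abs_of_nonneg (mul_nonneg (by positivity) (by linarith))]
    calc _ ≤ 1/v * u := by
          apply mul_le_mul g1 p1 (by linarith) (by positivity)
      _ = _ := by ring
  have b2 : |t * Real.exp (-(v*t)) - n * Real.exp (-(v*n))| ≤ 2 := by
    have q1 : Real.exp (-(v*t)) = Real.exp (-(v*n)) * Real.exp (-(v*(t-n))) := by
      rw [← Real.exp_add]; congr 1; ring
    have q2 : 1 - v ≤ Real.exp (-(v*(t-n))) := by
      have := Real.add_one_le_exp (-(v*(t-n)))
      nlinarith
    have q3 : Real.exp (-(v*(t-n))) ≤ 1 := by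
      rw [Real.exp_le_one_iff]
      have : 0 ≤ v*(t-n) := mul_nonneg hv.le (by linarith)
      linarith
    have q4 : Real.exp (-(v*t)) ≤ 1 := by
      rw [Real.exp_le_one_iff]
      have : 0 ≤ v*t := mul_nonneg hv.le ht0
      linarith
    have e1 : t * Real.exp (-(v*t)) - n * Real.exp (-(v*n)) =
      (t-n) * Real.exp (-(v*t)) - n * Real.exp (-(v*n)) * (1 - Real.exp (-(v*(t-n)))) := by
      rw [q1]; ring
    rw [e1]
    have r1 : 0 ≤ (t-n) * Real.exp (-(v*t)) := mul_nonneg (by linarith) hEt.le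
    have r2 : (t-n) * Real.exp (-(v*t)) ≤ 1 := by nlinarith
    have r3 : 0 ≤ n * Real.exp (-(v*n)) * (1 - Real.exp (-(v*(t-n)))) :=
      mul_nonneg (by positivity) (by linarith)
    have r4 : n * Real.exp (-(v*n)) * (1 - Real.exp (-(v*(t-n)))) ≤ 1 := by
      refine le_trans ?_ g2
      exact mul_le_mul_of_nonneg_left (by linarith) (by positivity)
    rw [abs_le]; constructor <;> linarith
  rw [Real.norm_eq_abs]
  rw [abs_le] at *
  constructor <;> linarith [d.1, d.2, b1.1, b1.2, b2.1, b2.2]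

lemma phd_bound {u v : ℝ} (hu : 0 < u) (hu1 : u ≤ 1) (hv : 0 < v) (hv2 : v ≤ 3/2) (n : ℕ) :
    |phd u v n - phi u v n| ≤ 22 * (1/u + 1/v) := by
  induction n with
  | zero => simp [phd, phi]; positivity
  | succ n ih =>
    rw [phi_step, phd]
    have s := step_bound hu hv hv2 n
    set J := ∫ t in (n:ℝ)..(n+1:ℕ), t * Real.exp (-(v*t)) * Real.exp (-(u*(n+1-t)))
    have h1 : |1 - u - Real.exp (-u)| ≤ u^2 := by
      have := Real.abs_exp_sub_one_sub_id_le (x := -u) (by rw [abs_neg, abs_of_pos hu]; exact hu1)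
      rw [← abs_neg]
      calc _ = |Real.exp (-u) - 1 - -u| := by congr 1; ring
        _ ≤ _ := by simpa using this
    have h2 : |phi u v n| ≤ 1/(u*v) := by
      rw [abs_of_nonneg (phi_nonneg (by positivity))]; exact phi_le hu hv (by positivity)
    have h3 : |(1 - u - Real.exp (-u)) * phi u v n| ≤ u/v := by
      rw [abs_mul]
      calc _ ≤ u^2 * (1/(u*v)) := mul_le_mul h1 h2 (abs_nonneg _) (by positivity)
        _ = u/v := by field_simp
    calc _ = |(1-u) * (phd u v n - phi u v n) + (1 - u - Real.exp (-u)) * phi u v n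
          + (n * (1-v)^(n-1) - J)| := by congr 1; ring
      _ ≤ |(1-u) * (phd u v n - phi u v n)| + |(1 - u - Real.exp (-u)) * phi u v n|
          + |n * (1-v)^(n-1) - J| := abs_add_three _ _ _
      _ ≤ (1-u) * (22 * (1/u + 1/v)) + u/v + (20 + u/v) := by
          gcongr
          rw [abs_mul, abs_of_nonneg (by linarith)]
          gcongr
      _ = 22 * (1/u + 1/v) - 2 - 20 * (u/v) := by field_simp; ring
      _ ≤ _ := by
          have : 0 < u/v := by positivity
          linarith

noncomputable def phd' (u v : ℝ) (n : ℕ) : ℝ := if v = 2 then 0 else phd u v n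

lemma phd'_bound {u v : ℝ} (hu : 0 < u) (hu1 : u ≤ 1) (hv : 0 < v) (hv2 : v ≤ 3/2 ∨ v = 2) (n : ℕ) :
    |phd' u v n - phi u v n| ≤ 22 * (1/u + 1/v) := by
  unfold phd'
  rcases hv2 with h | h
  · rw [if_neg (by linarith)]; exact phd_bound hu hu1 hv h n
  · rw [if_pos h, zero_sub, abs_neg, abs_of_nonneg (phi_nonneg (by positivity))]
    refine (phi_le hu hv (by positivity)).trans ?_
    rw [h]
    have h1 : 0 < 1/u := by positivity
    calc 1/(u*2) = 1/u/2 := by field_simp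
      _ ≤ _ := by linarith

noncomputable def EE (a a' : ℝ) (n : ℕ) : ℝ :=
  (1-a-a')^n + n * (a*a') * (1-a-a')^(n-1) - (1-a)^n * (1-a')^n

lemma taylor_bound {b d ρ : ℝ} (h1 : |b| ≤ ρ) (h2 : |b+d| ≤ ρ) (m : ℕ) :
    |b^(m+2) + ((m:ℝ)+2) * d * b^(m+1) - (b+d)^(m+2)| ≤ ((m:ℝ)+2)*((m:ℝ)+1)/2 * d^2 * ρ^m := by
  have hρ : 0 ≤ ρ := (abs_nonneg _).trans h1
  induction m with
  | zero =>
    have : b^(0+2) + (((0:ℕ):ℝ)+2) * d * b^(0+1) - (b+d)^(0+2) = -d^2 := by push_cast; ring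
    rw [this]; simp
  | succ m ih =>
    have : b^(m+1+2) + (((m+1:ℕ):ℝ)+2) * d * b^(m+1+1) - (b+d)^(m+1+2) =
      (b+d) * (b^(m+2) + ((m:ℝ)+2) * d * b^(m+1) - (b+d)^(m+2)) - ((m:ℝ)+2) * d^2 * b^(m+1) := by
      push_cast; ring
    rw [this]
    refine (abs_sub _ _).trans ?_
    have k1 : |(b+d) * (b^(m+2) + ((m:ℝ)+2) * d * b^(m+1) - (b+d)^(m+2))| ≤
        ρ * (((m:ℝ)+2)*((m:ℝ)+1)/2 * d^2 * ρ^m) := by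
      rw [abs_mul]; gcongr
    have k2 : |((m:ℝ)+2) * d^2 * b^(m+1)| ≤ ((m:ℝ)+2) * d^2 * ρ^(m+1) := by
      rw [abs_mul, abs_of_nonneg (by positivity), abs_pow]; gcongr
    calc _ ≤ _ := add_le_add k1 k2
      _ = _ := by push_cast; ring

lemma EE_bound {ε a a' : ℝ} (he : 0 < ε) (he2 : ε ≤ 1/2) (ha : ε ≤ a) (ha1 : a ≤ 1)
    (ha' : ε ≤ a') (ha1' : a' ≤ 1) (hs : a + a' ≤ 3/2) (n : ℕ) :
    |EE a a' n| ≤ 3 * (a*a')^2/ε^2 := by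
  rcases n with _ | _ | m
  · simp [EE]; positivity
  · have : EE a a' (0+1) = 0 := by simp [EE]; ring
    rw [this]; simp; positivity
  · have e : EE a a' (m+1+1) = (1-a-a')^(m+2) + ((m:ℝ)+2) * (a*a') * (1-a-a')^(m+1)
      - ((1-a-a')+(a*a'))^(m+2) := by
      unfold EE
      rw [← mul_pow, show (1-a)*(1-a') = (1-a-a')+(a*a') by ring]
      simp only [Nat.add_sub_cancel]
      push_cast; ring
    rw [e]
    refine (taylor_bound (ρ := 1-ε) ?_ ?_ m).trans ?_
    · rw [abs_le]; constructor <;> linarith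
    · rw [show 1-a-a'+a*a' = (1-a)*(1-a') by ring, abs_of_nonneg (mul_nonneg (by linarith) (by linarith))]
      nlinarith
    · have h1 : (1-ε)^m ≤ Real.exp (-ε)^m :=
        pow_le_pow_left₀ (by linarith) (by linarith [Real.add_one_le_exp (-ε)]) m
      have e2 : Real.exp (-ε)^m = Real.exp (-(ε*((m:ℝ)+2))) * Real.exp (2*ε) := by
        rw [← Real.exp_nat_mul, ← Real.exp_add]; congr 1; push_cast; ring
      have h2 := sq_exp_le (s := ε*((m:ℝ)+2)) (by positivity)
      have h3 : Real.exp (2*ε) ≤ 3 :=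
        (Real.exp_le_exp.2 (show 2*ε ≤ 1 by linarith)).trans (by linarith [Real.exp_one_lt_d9])
      rw [le_div_iff₀ (by positivity)]
      calc _ ≤ ((m:ℝ)+2)*((m:ℝ)+2)/2 * (a*a')^2 * (Real.exp (-(ε*((m:ℝ)+2))) * Real.exp (2*ε)) * ε^2 := by
            rw [← e2]
            have : 0 ≤ (1-ε)^m := pow_nonneg (by linarith) m
            gcongr; linarith
        _ = (a*a')^2 * (((ε*((m:ℝ)+2))^2 * Real.exp (-(ε*((m:ℝ)+2)))) * Real.exp (2*ε) / 2) := by ring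
        _ ≤ (a*a')^2 * (2 * 3 / 2) := by gcongr
        _ = _ := by ring

lemma EE_one (n : ℕ) : EE 1 1 n = - phd 1 2 n := by
  rcases n with _ | _ | m
  · simp [EE, phd]
  · simp [EE, phd]
  · simp [EE, phd]
    norm_num
    ring

noncomputable def WW (h : ℕ) : ℝ := |ww h| * 4^h

lemma choose_aux (h : ℕ) : 3*h ≤ h.choose 2 + 6 := by
  induction h with
  | zero => simp
  | succ h ih =>
    have e : (h+1).choose 2 = h + h.choose 2 := by
      rw [Nat.choose_succ_succ' h 1, Nat.choose_one_right]
    rw [e]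
    by_cases h3 : 3 ≤ h
    · omega
    · interval_cases h <;> simp

lemma ww_abs (h : ℕ) : |ww h| ≤ 4 * (1/2^(h.choose 2)) := by
  unfold ww
  rw [abs_div, abs_mul, abs_pow, abs_neg, abs_one, one_pow, one_mul, abs_of_pos (Q_pos h),
    abs_of_nonneg (by positivity), div_le_iff₀ (Q_pos h)]
  have h1 := Q_ge h
  have h2 : (0:ℝ) < 1/2^(h.choose 2) := by positivity
  nlinarith

lemma WW_nonneg (h : ℕ) : 0 ≤ WW h := by unfold WW; positivity

lemma WW_le (h : ℕ) : WW h ≤ 256 * (1/2)^h := by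
  unfold WW
  calc |ww h| * 4^h ≤ 4 * (1/2^(h.choose 2)) * 4^h := by gcongr; exact ww_abs h
    _ ≤ _ := by
      have h1 : (2:ℝ)^(3*h) ≤ 2^(h.choose 2 + 6) := pow_le_pow_right₀ (by norm_num) (choose_aux h)
      have h2 : (2:ℝ)^(3*h) = 4^h * 2^h := by
        rw [pow_mul, ← mul_pow]; norm_num
      rw [h2, pow_add] at h1
      rw [one_div_pow]
      rw [mul_one_div, mul_one_div, div_mul_eq_mul_div, div_le_div_iff₀ (by positivity) (by positivity)]
      nlinarith

lemma ww_le (h : ℕ) : |ww h| ≤ 256 * (1/2)^h := by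
  refine le_trans ?_ (WW_le h)
  unfold WW
  exact le_mul_of_one_le_right (abs_nonneg _) (one_le_pow₀ (by norm_num))

lemma WW_sum (N : ℕ) : ∑ h ∈ Finset.range N, WW h ≤ 512 := by
  calc _ ≤ ∑ h ∈ Finset.range N, 256 * (1/2:ℝ)^h := Finset.sum_le_sum fun h _ => WW_le h
    _ = 256 * ∑ h ∈ Finset.range N, (1/2:ℝ)^h := by rw [Finset.mul_sum]
    _ ≤ 256 * 2 := by gcongr; exact sum_geometric_two_le N
    _ = 512 := by norm_num

lemma Th_le (j h l : ℕ) : |Th j h l| ≤ 16 * (WW h * WW l) := by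
  have key : ∀ m i : ℕ, |ww m * 4^m / Q i| ≤ 4 * WW m := by
    intro m i
    rw [abs_div, abs_mul, abs_of_pos (Q_pos i), abs_of_nonneg (a := (4:ℝ)^m) (by positivity),
      div_le_iff₀ (Q_pos i)]
    have h1 := Q_ge i
    have h2 := WW_nonneg m
    change WW m ≤ _
    nlinarith
  unfold Th
  rw [abs_mul]
  calc _ ≤ (4 * WW h) * (4 * WW l) := mul_le_mul (key _ _) (key _ _) (abs_nonneg _)
          (by have := WW_nonneg h; positivity)
    _ = _ := by ring

lemma dsum_le (N : ℕ) (f : ℕ → ℕ → ℝ) (B : ℝ) (hB : 0 ≤ B)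
    (hf : ∀ h < N, ∀ l < N, |f h l| ≤ B * (WW h * WW l)) :
    |∑ h ∈ Finset.range N, ∑ l ∈ Finset.range N, f h l| ≤ 512^2 * B := by
  calc _ ≤ ∑ h ∈ Finset.range N, ∑ l ∈ Finset.range N, B * (WW h * WW l) := by
        refine (Finset.abs_sum_le_sum_abs _ _).trans (Finset.sum_le_sum fun h hh => ?_)
        refine (Finset.abs_sum_le_sum_abs _ _).trans (Finset.sum_le_sum fun l hl => ?_)
        exact hf h (Finset.mem_range.1 hh) l (Finset.mem_range.1 hl)
    _ = B * ((∑ h ∈ Finset.range N, WW h) * ∑ l ∈ Finset.range N, WW l) := by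
        rw [Finset.sum_mul_sum, Finset.mul_sum]
        exact Finset.sum_congr rfl fun _ _ => by rw [Finset.mul_sum]
    _ ≤ B * (512 * 512) := by
        have h1 := WW_sum N
        have h0 : 0 ≤ ∑ h ∈ Finset.range N, WW h := Finset.sum_nonneg fun h _ => WW_nonneg h
        gcongr
    _ = _ := by ring

lemma Thsum_le (j : ℕ) (f : ℕ → ℕ → ℝ) (B : ℝ) (hB : 0 ≤ B)
    (hf : ∀ h ≤ j, ∀ l ≤ j, |f h l| ≤ B) :
    |∑ h ∈ Finset.range (j+1), ∑ l ∈ Finset.range (j+1), Th j h l * f h l| ≤ 2^22 * B := by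
  refine (dsum_le (j+1) _ (16*B) (by positivity) ?_).trans (by norm_num; linarith)
  intro h hh l hl
  rw [abs_mul]
  calc _ ≤ (16 * (WW h * WW l)) * B := by
        have := WW_nonneg h
        have := WW_nonneg l
        gcongr
        · exact Th_le j h l
        · exact hf h (by omega) l (by omega)
    _ = _ := by ring

noncomputable def SS (f : ℝ → ℝ → ℕ → ℝ) (n k j r : ℕ) : ℝ :=
  ∑ h ∈ Finset.range (j+1), ∑ l ∈ Finset.range (j+1),
    Th j h l * f (al k (r+j)) ((2^h+2^l)/2^k) n

noncomputable def TT (f : ℝ → ℝ → ℕ → ℝ) (n k j r : ℕ) : ℝ :=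
  2^k/4^k * (1/2^j) * (ww r / Q (k-j-r)) * SS f n k j r

lemma AA_eq (n k : ℕ) : AA n k = ∑ j ∈ Finset.range (k+1), ∑ r ∈ Finset.range (k-j+1),
    TT phd n k j r := by
  unfold AA
  rw [Finset.mul_sum]
  apply Finset.sum_congr rfl
  intro j _
  unfold TT SS II
  simp only [Finset.mul_sum]
  rw [Finset.sum_comm (s := Finset.range (k-j+1)) (t := Finset.range (j+1))]
  apply Finset.sum_congr rfl
  intro h _
  rw [Finset.sum_comm]
  apply Finset.sum_congr rfl
  intro r _
  apply Finset.sum_congr rfl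
  intro l _
  ring

lemma vne {k h l : ℕ} (hh : h ≤ k) (hl : l ≤ k) (hne : ¬ (h = k ∧ l = k)) :
    ((2:ℝ)^h+2^l)/2^k ≤ 3/2 := by
  rcases k with _ | k
  · omega
  rw [div_le_iff₀ (by positivity)]
  have p1 : (2:ℝ)^h ≤ 2^(k+1) := pow_le_pow_right₀ (by norm_num) hh
  have p2 : (2:ℝ)^l ≤ 2^(k+1) := pow_le_pow_right₀ (by norm_num) hl
  have e : (2:ℝ)^(k+1) = 2*2^k := pow_succ' 2 k
  by_cases h1 : h = k+1
  · have : (2:ℝ)^l ≤ 2^k := pow_le_pow_right₀ (by norm_num) (by omega)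
    linarith
  · have : (2:ℝ)^h ≤ 2^k := pow_le_pow_right₀ (by norm_num) (by omega)
    linarith

lemma v2 (k : ℕ) : ((2:ℝ)^k+2^k)/2^k = 2 := by
  have : (2:ℝ)^k ≠ 0 := by positivity
  field_simp; norm_num

lemma AA_split (n k : ℕ) : AA n k = ∑ j ∈ Finset.range (k+1), ∑ r ∈ Finset.range (k-j+1),
    TT phd' n k j r + cf k k * cf k k * phd 1 2 n := by
  rw [AA_eq, ← sub_eq_iff_eq_add', ← Finset.sum_sub_distrib]
  simp only [← Finset.sum_sub_distrib]
  have e : ∀ j r, TT phd n k j r - TT phd' n k j r = 2^k/4^k * (1/2^j) * (ww r / Q (k-j-r)) *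
      ∑ h ∈ Finset.range (j+1), ∑ l ∈ Finset.range (j+1), Th j h l *
        (phd (al k (r+j)) ((2^h+2^l)/2^k) n - phd' (al k (r+j)) ((2^h+2^l)/2^k) n) := by
    intro j r
    unfold TT SS
    rw [← mul_sub, ← Finset.sum_sub_distrib]
    simp only [← Finset.sum_sub_distrib, ← mul_sub]
  have z : ∀ h l : ℕ, ∀ u : ℝ, h ≤ k → l ≤ k → ¬ (h = k ∧ l = k) →
      phd u ((2^h+2^l)/2^k) n - phd' u ((2^h+2^l)/2^k) n = 0 := by
    intro h l u hh hl hne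
    have := vne hh hl hne
    rw [phd', if_neg (by linarith), sub_self]
  simp only [e]
  rw [Finset.sum_eq_single k]
  · rw [Nat.sub_self, zero_add, Finset.sum_range_one, Finset.sum_eq_single k, Finset.sum_eq_single k]
    · rw [v2, zero_add, al_self, phd', if_pos rfl]
      have := Th_cf k k k
      rw [al_self] at this
      have e2 : (2:ℝ)^k/4^k * (1/2^k) = 1/4^k := by field_simp
      rw [e2, ww_zero, Nat.sub_zero, Q_zero, sub_zero, div_one, mul_one, ← mul_assoc, this]
      ring
    · intro l hl hne
      rw [z k l _ le_rfl (by have := Finset.mem_range.1 hl; omega) (by omega), mul_zero]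
    · simp
    · intro h hh hne
      apply Finset.sum_eq_zero
      intro l hl
      rw [z h l _ (by have := Finset.mem_range.1 hh; omega) (by have := Finset.mem_range.1 hl; omega)
        (by omega), mul_zero]
    · simp
  · intro j hj hne
    have hj := Finset.mem_range.1 hj
    apply Finset.sum_eq_zero
    intro r _
    rw [Finset.sum_eq_zero, mul_zero]
    intro h hh
    have := Finset.mem_range.1 hh
    apply Finset.sum_eq_zero
    intro l hl
    have := Finset.mem_range.1 hl
    rw [z h l _ (by omega) (by omega) (by omega), mul_zero]
  · simp

lemma RB_sub (n k : ℕ) : RB n k - (mu n k)^2 = ∑ h ∈ Finset.range (k+1), ∑ l ∈ Finset.range (k+1),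
    cf k h * cf k l * EE (al k h) (al k l) n := by
  unfold RB
  rw [mu_eq, sq, Finset.sum_mul_sum, ← Finset.sum_sub_distrib]
  apply Finset.sum_congr rfl
  intro h _
  rw [Finset.mul_sum, ← Finset.sum_sub_distrib]
  apply Finset.sum_congr rfl
  intro l _
  unfold EE
  ring

lemma al_pos (k h : ℕ) : 0 < al k h := by unfold al; positivity
lemma al_le {k h : ℕ} (hh : h ≤ k) : al k h ≤ 1 := by
  unfold al
  rw [div_le_one (by positivity)]
  exact pow_le_pow_right₀ (by norm_num) hh
lemma al_ge (k h : ℕ) : 1/2^k ≤ al k h := by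
  unfold al
  gcongr
  exact one_le_pow₀ (by norm_num)

lemma R_bound (n k : ℕ) :
    |RB n k - (mu n k)^2 + cf k k * cf k k * phd 1 2 n| ≤ 512^2 * 48 := by
  have e : RB n k - (mu n k)^2 + cf k k * cf k k * phd 1 2 n =
      ∑ h ∈ Finset.range (k+1), ∑ l ∈ Finset.range (k+1),
      (if h = k ∧ l = k then 0 else cf k h * cf k l * EE (al k h) (al k l) n) := by
    rw [RB_sub]
    apply eq_of_sub_eq_zero
    rw [add_sub_right_comm, ← eq_neg_iff_add_eq_zero, ← Finset.sum_sub_distrib]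
    simp only [← Finset.sum_sub_distrib]
    rw [Finset.sum_eq_single k, Finset.sum_eq_single k]
    · rw [if_pos ⟨rfl, rfl⟩, al_self, EE_one]; ring
    · intro l _ hne
      rw [if_neg (by omega), sub_self]
    · simp
    · intro h _ hne
      apply Finset.sum_eq_zero
      intro l _
      rw [if_neg (by omega), sub_self]
    · simp
  rw [e]
  apply dsum_le _ _ _ (by norm_num)
  intro h hh l hl
  have := WW_nonneg h
  have := WW_nonneg l
  split_ifs with hc
  · rw [abs_zero]; positivity
  · rcases k with _ | k
    · omega
    have he2 : (1:ℝ)/2^(k+1) ≤ 1/2 := by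
      rw [pow_succ]
      have : (1:ℝ) ≤ 2^k := one_le_pow₀ (by norm_num)
      rw [div_le_div_iff₀ (by positivity) (by norm_num)]; linarith
    have hs : al (k+1) h + al (k+1) l ≤ 3/2 := by
      unfold al; rw [← add_div]; exact vne (by omega) (by omega) hc
    have b := EE_bound (by positivity) he2 (al_ge (k+1) h) (al_le (by omega)) (al_ge (k+1) l)
      (al_le (by omega)) hs n
    have cb : ∀ m, |cf (k+1) m| ≤ 4 * 2^(k+1) * |ww m| := by
      intro m
      unfold cf
      rw [abs_mul, abs_div, abs_of_pos (Q_pos _), abs_of_nonneg (by positivity)]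
      have h1 : |ww m| / Q (k+1-m) ≤ 4 * |ww m| := by
        rw [div_le_iff₀ (Q_pos _)]
        have := Q_ge (k+1-m)
        have := abs_nonneg (ww m)
        nlinarith
      calc _ ≤ (2:ℝ)^(k+1) * (4 * |ww m|) := by gcongr
        _ = _ := by ring
    rw [abs_mul, abs_mul]
    calc _ ≤ (4 * 2^(k+1) * |ww h|) * (4 * 2^(k+1) * |ww l|) *
          (3 * (al (k+1) h * al (k+1) l)^2/(1/2^(k+1))^2) := by
          gcongr
          · exact cb h
          · exact cb l
      _ = 48 * (WW h * WW l) := by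
          unfold WW al
          rw [show (4:ℝ) = 2^2 by norm_num]
          simp only [← pow_mul, mul_comm 2]
          simp only [pow_mul]
          field_simp
          norm_num
          ring

noncomputable def phR (u v : ℝ) (n : ℕ) : ℝ := phi u v n

lemma phi_scale (k n : ℕ) (U V : ℝ) :
    phi U V ((2:ℝ)^(-(k:ℤ)) * n) = 1/4^k * phi (U/2^k) (V/2^k) n := by
  have hc : (2:ℝ)^(-(k:ℤ)) = (2^k)⁻¹ := by rw [zpow_neg, zpow_natCast]
  have hp : (2:ℝ)^k ≠ 0 := by positivity
  rw [hc]
  unfold phi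
  have := intervalIntegral.integral_comp_mul_left (a := 0) (b := (n:ℝ))
    (fun t => t * Real.exp ((U-V)*t)) (inv_ne_zero hp)
  rw [mul_zero, inv_inv, smul_eq_mul] at this
  have e2 : ∫ t in (0:ℝ)..(n:ℝ), (2^k)⁻¹ * t * Real.exp ((U-V)*((2^k)⁻¹*t)) =
      (2^k)⁻¹ * ∫ t in (0:ℝ)..(n:ℝ), t * Real.exp ((U/2^k-V/2^k)*t) := by
    rw [← intervalIntegral.integral_const_mul]
    apply intervalIntegral.integral_congr
    intro t _
    beta_reduce
    rw [mul_assoc]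
    congr 3
    field_simp
  rw [e2] at this
  have e3 : (4:ℝ)^k = 2^k * 2^k := by rw [← mul_pow]; norm_num
  rw [show -U * ((2^k)⁻¹ * (n:ℝ)) = -(U/2^k) * n by field_simp]
  generalize (∫ t in (0:ℝ)..(2^k)⁻¹ * (n:ℝ), t * Real.exp ((U-V)*t)) = I1 at *
  generalize (∫ t in (0:ℝ)..(n:ℝ), t * Real.exp ((U/2^k-V/2^k)*t)) = I2 at *
  have : I1 = 1/4^k * I2 := by
    rw [e3]; field_simp; field_simp at this; linarith
  rw [this]; ring

noncomputable def Gt (x : ℝ) (j r : ℕ) : ℝ :=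
  ∑ h ∈ Finset.range (j+1), ∑ l ∈ Finset.range (j+1),
    (-1:ℝ)^(r+h+l) *
      (2:ℝ)^(-(j:ℤ) - (r.choose 2 : ℤ) - (h.choose 2 : ℤ) - (l.choose 2 : ℤ)
        + 2*(h:ℤ) + 2*(l:ℤ)) *
      phi ((2:ℝ)^(r+j)) ((2:ℝ)^h + (2:ℝ)^l) x /
      (Qinf * Q r * Q h * Q (j-h) * Q l * Q (j-l))

lemma Gt_eq (n k j r : ℕ) : 2^k * Gt ((2:ℝ)^(-(k:ℤ)) * n) j r =
    2^k/4^k * (1/2^j) * (ww r / Qinf) * SS phR n k j r := by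
  unfold Gt SS phR
  rw [Finset.mul_sum, Finset.mul_sum]
  apply Finset.sum_congr rfl
  intro h _
  rw [Finset.mul_sum, Finset.mul_sum]
  apply Finset.sum_congr rfl
  intro l _
  rw [phi_scale]
  have e : (2:ℝ)^(-(j:ℤ) - (r.choose 2 : ℤ) - (h.choose 2 : ℤ) - (l.choose 2 : ℤ)
        + 2*(h:ℤ) + 2*(l:ℤ)) = 1/2^j * (1/2^(r.choose 2)) * (1/2^(h.choose 2)) * (1/2^(l.choose 2))
          * 4^h * 4^l := by
    rw [zpow_add₀ (by norm_num), zpow_add₀ (by norm_num), zpow_sub₀ (by norm_num),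
      zpow_sub₀ (by norm_num), zpow_sub₀ (by norm_num), zpow_neg, zpow_mul, zpow_mul]
    simp only [zpow_natCast, one_div]
    norm_num
    simp only [div_eq_mul_inv]
  rw [e]
  unfold Th ww al
  have := Qinf_pos.ne'
  have := Q_ne r
  have := Q_ne h
  have := Q_ne l
  have := Q_ne (j-h)
  have := Q_ne (j-l)
  rw [pow_add (-1:ℝ), pow_add (-1:ℝ)]
  field_simp

lemma v_pos (k h l : ℕ) : 0 < ((2:ℝ)^h+2^l)/2^k := by positivity
lemma v_inv (k h l : ℕ) : 1/(((2:ℝ)^h+2^l)/2^k) ≤ 2^k := by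
  rw [one_div_div]
  apply div_le_self (by positivity)
  have : (1:ℝ) ≤ 2^h := one_le_pow₀ (by norm_num)
  have : (0:ℝ) < 2^l := by positivity
  linarith
lemma u_inv (k h : ℕ) : 1/al k h = 2^k/2^h := by unfold al; rw [one_div_div]

lemma phR_le (n k i h l : ℕ) : |phR (al k i) ((2^h+2^l)/2^k) n| ≤ 4^k/2^i := by
  unfold phR
  rw [abs_of_nonneg (phi_nonneg (by positivity))]
  refine (phi_le (al_pos k i) (v_pos k h l) (by positivity)).trans ?_
  rw [← div_div, u_inv]
  have h1 := v_inv k h l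
  rw [div_eq_mul_one_div]
  calc _ ≤ (2:ℝ)^k/2^i * 2^k := by gcongr
    _ = _ := by rw [div_mul_eq_mul_div, ← mul_pow]; norm_num

lemma term_bound (n k j r : ℕ) :
    |2^k * Gt ((2:ℝ)^(-(k:ℤ)) * n) j r - (if r + j ≤ k then TT phd' n k j r else 0)| ≤
      2^40 * (1/2)^j * (1/2)^r := by
  have hS : |SS phR n k j r| ≤ 2^22 * (4^k/2^(r+j)) :=
    Thsum_le j _ _ (by positivity) fun h _ l _ => phR_le n k (r+j) h l
  have hw := ww_le r
  rw [Gt_eq]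
  have hfin : (2:ℝ)^30 * (1/2^j) * |ww r| ≤ 2^40 * (1/2)^j * (1/2)^r := by
    calc _ ≤ (2:ℝ)^30 * (1/2^j) * (256 * (1/2)^r) := by gcongr
      _ = 2^38 * ((1/2)^j * (1/2)^r) := by rw [one_div_pow 2 j]; ring
      _ ≤ 2^40 * ((1/2)^j * (1/2)^r) := by gcongr <;> norm_num
      _ = _ := by ring
  refine le_trans ?_ hfin
  have e4 : (2:ℝ)^k/4^k = 1/2^k := by
    rw [show (4:ℝ)^k = 2^k * 2^k by rw [← mul_pow]; norm_num]; field_simp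
  have e4' : (4:ℝ)^k = 2^k * 2^k := by rw [← mul_pow]; norm_num
  rw [e4]
  split_ifs with hc
  · have hu1 : al k (r+j) ≤ 1 := al_le hc
    have hD : |SS phd' n k j r - SS phR n k j r| ≤ 2^22 * (22 * (2^k + 2^k)) := by
      have e : SS phd' n k j r - SS phR n k j r =
          ∑ h ∈ Finset.range (j+1), ∑ l ∈ Finset.range (j+1), Th j h l *
          (phd' (al k (r+j)) ((2^h+2^l)/2^k) n - phR (al k (r+j)) ((2^h+2^l)/2^k) n) := by
        unfold SS
        rw [← Finset.sum_sub_distrib]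
        simp only [← Finset.sum_sub_distrib, ← mul_sub]
      rw [e]
      apply Thsum_le j _ _ (by positivity)
      intro h hh l hl
      have hv : ((2:ℝ)^h+2^l)/2^k ≤ 3/2 ∨ ((2:ℝ)^h+2^l)/2^k = 2 := by
        by_cases hk : h = k ∧ l = k
        · right; rw [hk.1, hk.2]; exact v2 k
        · left; exact vne (by omega) (by omega) hk
      refine (phd'_bound (al_pos _ _) hu1 (v_pos k h l) hv n).trans ?_
      have := v_inv k h l
      have : 1/al k (r+j) ≤ 2^k := by
        rw [u_inv]; exact div_le_self (by positivity) (one_le_pow₀ (by norm_num))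
      gcongr
    unfold TT
    rw [e4]
    have hQ : |1/Q (k-j-r)| ≤ 4 := by
      rw [abs_of_pos (by have := Q_pos (k-j-r); positivity), div_le_iff₀ (Q_pos _)]
      linarith [Q_ge (k-j-r)]
    have hQd := invQ_diff (k-j-r)
    have epow : (2:ℝ)^k = 2^(k-j-r) * 2^(r+j) := by rw [← pow_add]; congr 1; omega
    rw [abs_sub_comm]
    have b1 : |1/Q (k-j-r) * (SS phd' n k j r - SS phR n k j r)| ≤ 4 * (2^22 * (22 * (2^k + 2^k))) := by
      rw [abs_mul]; gcongr
    have b2 : |(1/Q (k-j-r) - 1/Qinf) * SS phR n k j r| ≤ 2^22 * 16 * 2^k := by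
      rw [abs_mul]
      calc _ ≤ ((16:ℝ)/2^(k-j-r)) * (2^22 * (4^k/2^(r+j))) := by gcongr
        _ = 2^22 * 16 * 2^k * (2^k / (2^(k-j-r) * 2^(r+j))) := by rw [e4']; field_simp
        _ = _ := by rw [← epow, div_self (by positivity), mul_one]
    calc _ = |1/2^k * (1/2^j) * ww r * (1/Q (k-j-r) * (SS phd' n k j r - SS phR n k j r) +
          (1/Q (k-j-r) - 1/Qinf) * SS phR n k j r)| := by congr 1; ring
      _ = 1/2^k * (1/2^j) * |ww r| * |1/Q (k-j-r) * (SS phd' n k j r - SS phR n k j r) +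
          (1/Q (k-j-r) - 1/Qinf) * SS phR n k j r| := by
          rw [abs_mul, abs_mul, abs_of_nonneg (by positivity)]
      _ ≤ 1/2^k * (1/2^j) * |ww r| * (4 * (2^22 * (22 * (2^k + 2^k))) + 2^22 * 16 * 2^k) := by
          gcongr
          exact (abs_add_le _ _).trans (add_le_add b1 b2)
      _ = (2^22 * 192) * (1/2^j) * |ww r| := by field_simp; ring
      _ ≤ _ := by gcongr; norm_num
  · rw [sub_zero, abs_mul, abs_mul, abs_div, abs_of_pos Qinf_pos, abs_of_nonneg (by positivity)]
    have hq : |ww r| / Qinf ≤ 4 * |ww r| := by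
      rw [div_le_iff₀ Qinf_pos]
      have := Qinf_ge
      have := abs_nonneg (ww r)
      nlinarith
    have hle : (2:ℝ)^k/2^(r+j) ≤ 1 := by
      rw [div_le_one (by positivity)]
      exact pow_le_pow_right₀ (by norm_num) (by omega)
    calc _ ≤ 1/2^k * (1/2^j) * (4 * |ww r|) * (2^22 * (4^k/2^(r+j))) := by
          gcongr
      _ = 2^24 * (1/2^j) * |ww r| * (2^k/2^(r+j)) := by rw [e4']; field_simp; ring
      _ ≤ 2^24 * (1/2^j) * |ww r| * 1 := by gcongr
      _ ≤ _ := by rw [mul_one]; gcongr <;> norm_num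

lemma G_diff (n k : ℕ) : |(2:ℝ)^k * G ((2:ℝ)^(-(k:ℤ)) * n) -
    ∑ j ∈ Finset.range (k+1), ∑ r ∈ Finset.range (k-j+1), TT phd' n k j r| ≤ 2^42 := by
  set x := (2:ℝ)^(-(k:ℤ)) * n with hx
  set T : ℕ → ℕ → ℝ := fun j r => if r + j ≤ k then TT phd' n k j r else 0 with hT
  set D : ℕ → ℕ → ℝ := fun j r => 2^k * Gt x j r - T j r with hD
  have hb : ∀ j r, ‖D j r‖ ≤ 2^40 * (1/2)^j * (1/2)^r := fun j r => term_bound n k j r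
  have hg : HasSum (fun r : ℕ => (1/2:ℝ)^r) 2 := hasSum_geometric_two
  have hDr : ∀ j, Summable (D j) := fun j =>
    Summable.of_norm_bounded (hg.mul_left (2^40 * (1/2)^j)).summable (hb j)
  have hDj : ∀ j, ‖∑' r, D j r‖ ≤ 2^40 * (1/2)^j * 2 := fun j =>
    tsum_of_norm_bounded (hg.mul_left (2^40 * (1/2)^j)) (hb j)
  have hg2 : HasSum (fun j : ℕ => 2^40 * (1/2:ℝ)^j * 2) (2^40 * 2 * 2) :=
    (hg.mul_left (2^40)).mul_right 2
  have hDs : Summable (fun j => ∑' r, D j r) := Summable.of_norm_bounded hg2.summable hDj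
  have hDt := tsum_of_norm_bounded hg2 hDj
  have hTz : ∀ j, ∀ r ∉ Finset.range (k-j+1), T j r = 0 := by
    intro j r hr
    rw [Finset.mem_range] at hr
    simp only [hT]
    rw [if_neg (by omega)]
  have hTr : ∀ j, Summable (T j) := fun j => summable_of_ne_finset_zero (hTz j)
  have hTz2 : ∀ j ∉ Finset.range (k+1), ∑' r, T j r = 0 := by
    intro j hj
    rw [Finset.mem_range] at hj
    have : ∀ r, T j r = 0 := fun r => by
      simp only [hT]; rw [if_neg (by omega)]
    simp [this]
  have hTs : Summable (fun j => ∑' r, T j r) := summable_of_ne_finset_zero hTz2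
  have hTt : ∑' j, ∑' r, T j r =
      ∑ j ∈ Finset.range (k+1), ∑ r ∈ Finset.range (k-j+1), TT phd' n k j r := by
    rw [tsum_eq_sum hTz2]
    apply Finset.sum_congr rfl
    intro j hj
    rw [tsum_eq_sum (hTz j)]
    apply Finset.sum_congr rfl
    intro r hr
    have := Finset.mem_range.1 hr
    have := Finset.mem_range.1 hj
    simp only [hT]
    rw [if_pos (by omega)]
  have hG : (2:ℝ)^k * G x = ∑' j, ∑' r, D j r + ∑' j, ∑' r, T j r := by
    rw [← hDs.tsum_add hTs]
    have : G x = ∑' j, ∑' r, Gt x j r := rfl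
    rw [this, ← tsum_mul_left]
    congr 1
    ext j
    rw [← (hDr j).tsum_add (hTr j), ← tsum_mul_left]
    congr 1
    ext r
    simp only [hD]; ring
  rw [hG, hTt, add_sub_cancel_right, ← Real.norm_eq_abs]
  refine hDt.trans (by norm_num)


/-- `Var(B_{n,k}) = 2^k G(2^{-k} n) + O(1)` uniformly for `0 ≤ k ≤ n`. -/
theorem variance_external_profile : ∃ C > (0:ℝ), ∀ n k : ℕ, k ≤ n →
    |(nu n k - (mu n k)^2) - (2:ℝ)^k * G ((2:ℝ)^(-(k:ℤ)) * n)| ≤ C := by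
  refine ⟨2^42 + 512^2 * 48, by norm_num, ?_⟩
  intro n k _
  have h1 := G_diff n k
  have h2 := R_bound n k
  have h3 := AA_split n k
  have h4 := nu_eq n k
  rw [abs_le] at *
  constructor <;> linarith [h1.1, h1.2, h2.1, h2.2]
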